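/- Let b̄ be any feasible point in P(𝒜,𝒢). Then there exists an acyclic solution b^forest ∈ P(𝒜,𝒢) with b^forest_{ij} = 0 whenever b̄_{ij} = 0 such that f_cvx(b^forest) ≥ f_cvx(b̄) − D_KL(w‖u). -/

import Mathlib

open Finset

/-- The feasibility polytope `P(𝒜,𝒢)`. -/
def Feasible {A G : Type*} [Fintype A] [Fintype G] (b : A → G → ℝ) : Prop :=
  (∀ i j, 0 ≤ b i j) ∧ (∀ i, ∑ j, b i j = 1) ∧ (∀ j, ∑ i, b i j ≤ 1)

/-- The support graph of `b`: bipartite graph on `𝒜 ⊕ 𝒢` with an edge `{i,j}` iff `b i j > 0`. -/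
def supportGraph {A G : Type*} (b : A → G → ℝ) : SimpleGraph (A ⊕ G) :=
  SimpleGraph.fromRel (fun x y => ∃ i j, x = Sum.inl i ∧ y = Sum.inr j ∧ 0 < b i j)

/-- The objective of the convex program CVX-Weighted. -/
noncomputable def fcvx {A G : Type*} [Fintype A] [Fintype G]
    (v : A → G → ℝ) (w : A → ℝ) (b : A → G → ℝ) : ℝ :=
  (∑ i, ∑ j, w i * b i j * Real.log (v i j))
    - ∑ j, (∑ i, w i * b i j) * Real.log (∑ i, w i * b i j)
    + ∑ i, w i * Real.log (w i)

/-- KL-divergence between the weights `w` and the uniform distribution on the agents. -/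
noncomputable def DKL {A : Type*} [Fintype A] (w : A → ℝ) : ℝ :=
  Real.log (Fintype.card A) + ∑ i, w i * Real.log (w i)

theorem supportGraph_adj_iff {A G : Type*} (b : A → G → ℝ) (x y : A ⊕ G) :
    (supportGraph b).Adj x y ↔ ∃ i j, 0 < b i j ∧
      ((x = Sum.inl i ∧ y = Sum.inr j) ∨ (x = Sum.inr j ∧ y = Sum.inl i)) := by
  unfold supportGraph
  rw [SimpleGraph.fromRel_adj]
  constructor
  · rintro ⟨-, ⟨i, j, h1, h2, h3⟩ | ⟨i, j, h1, h2, h3⟩⟩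
    · exact ⟨i, j, h3, Or.inl ⟨h1, h2⟩⟩
    · exact ⟨i, j, h3, Or.inr ⟨h2, h1⟩⟩
  · rintro ⟨i, j, h3, ⟨rfl, rfl⟩ | ⟨rfl, rfl⟩⟩
    · exact ⟨by simp, Or.inl ⟨i, j, rfl, rfl, h3⟩⟩
    · exact ⟨by simp, Or.inr ⟨i, j, rfl, rfl, h3⟩⟩

open Classical in
/-- Each edge of the support graph carries a signed matrix unit whose row and column sums are the
boundary of the oriented edge. -/
theorem exists_unit_flow_of_adj {A G : Type*} [Fintype A] [Fintype G] {b : A → G → ℝ}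
    {x y : A ⊕ G} (h : (supportGraph b).Adj x y) :
    ∃ e : A → G → ℝ,
      (∀ i, ∑ j, e i j = (if x = Sum.inl i then 1 else 0) - (if y = Sum.inl i then 1 else 0)) ∧
      (∀ j, ∑ i, e i j = (if y = Sum.inr j then 1 else 0) - (if x = Sum.inr j then 1 else 0)) ∧
      (∀ i j, e i j ≠ 0 ↔ s(Sum.inl i, Sum.inr j) = s(x, y)) := by
  obtain ⟨i₀, j₀, -, ⟨rfl, rfl⟩ | ⟨rfl, rfl⟩⟩ := (supportGraph_adj_iff b x y).1 h
  · refine ⟨fun i j => if i₀ = i ∧ j₀ = j then 1 else 0, fun i => ?_, fun j => ?_, fun i j => ?_⟩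
    · by_cases hi : i₀ = i <;> simp [hi]
    · by_cases hj : j₀ = j <;> simp [hj]
    · simp [eq_comm]
  · refine ⟨fun i j => if i₀ = i ∧ j₀ = j then -1 else 0, fun i => ?_, fun j => ?_, fun i j => ?_⟩
    · by_cases hi : i₀ = i <;> simp [hi]
    · by_cases hj : j₀ = j <;> simp [hj]
    · simp [eq_comm, and_comm]

open Classical in
/-- Every walk in the support graph carries a signed matrix, supported on the edges of the walk,
whose row and column sums are the boundary of the walk. -/
theorem exists_flow_of_walk {A G : Type*} [Fintype A] [Fintype G] {b : A → G → ℝ}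
    {x y : A ⊕ G} (p : (supportGraph b).Walk x y) :
    ∃ d : A → G → ℝ,
      (∀ i, ∑ j, d i j = (if x = Sum.inl i then 1 else 0) - (if y = Sum.inl i then 1 else 0)) ∧
      (∀ j, ∑ i, d i j = (if y = Sum.inr j then 1 else 0) - (if x = Sum.inr j then 1 else 0)) ∧
      (∀ i j, d i j ≠ 0 → s(Sum.inl i, Sum.inr j) ∈ p.edges) := by
  induction p with
  | nil => exact ⟨fun _ _ => 0, by simp, by simp, by simp⟩
  | cons h p ih =>
    obtain ⟨d, hd1, hd2, hd3⟩ := ih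
    obtain ⟨e, he1, he2, he3⟩ := exists_unit_flow_of_adj h
    refine ⟨fun i j => e i j + d i j, fun i => ?_, fun j => ?_, fun i j hij => ?_⟩
    · rw [sum_add_distrib, he1, hd1]; ring
    · rw [sum_add_distrib, he2, hd2]; ring
    · rw [SimpleGraph.Walk.edges_cons, List.mem_cons]
      by_cases h0 : e i j = 0
      · exact Or.inr (hd3 i j (by simpa [h0] using hij))
      · exact Or.inl ((he3 i j).1 h0)

/-- A cycle in the support graph yields a nonzero direction in the support with vanishing row and
column sums. -/
theorem exists_circulation_of_not_isAcyclic {A G : Type*} [Fintype A] [Fintype G] {b : A → G → ℝ}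
    (h : ¬ (supportGraph b).IsAcyclic) :
    ∃ d : A → G → ℝ, (∀ i, ∑ j, d i j = 0) ∧ (∀ j, ∑ i, d i j = 0) ∧
      (∀ i j, d i j ≠ 0 → 0 < b i j) ∧ ∃ i j, d i j ≠ 0 := by
  unfold SimpleGraph.IsAcyclic at h
  push Not at h
  obtain ⟨x, c, hc⟩ := h
  cases c with
  | nil => simp at hc
  | @cons _ y _ h p =>
    obtain ⟨d, hd1, hd2, hd3⟩ := exists_flow_of_walk p
    obtain ⟨e, he1, he2, he3⟩ := exists_unit_flow_of_adj h
    have hnot := ((SimpleGraph.Walk.isTrail_cons h p).1 hc.isTrail).2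
    have hpos : ∀ i j, (supportGraph b).Adj (Sum.inl i) (Sum.inr j) → 0 < b i j := by
      intro i j hadj
      simpa using (supportGraph_adj_iff b _ _).1 hadj
    refine ⟨fun i j => e i j + d i j, fun i => ?_, fun j => ?_, fun i j hij => hpos i j ?_, ?_⟩
    · rw [sum_add_distrib, he1, hd1]; ring
    · rw [sum_add_distrib, he2, hd2]; ring
    · by_cases h0 : e i j = 0
      · exact p.adj_of_mem_edges (hd3 i j (by simpa [h0] using hij))
      · rw [← SimpleGraph.mem_edgeSet, (he3 i j).1 h0]
        exact h
    · obtain ⟨i, j, hij⟩ : ∃ i j, s(Sum.inl i, Sum.inr j) = s(x, y) := by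
        obtain ⟨i, j, -, ⟨h1, h2⟩ | ⟨h1, h2⟩⟩ := (supportGraph_adj_iff b _ _).1 h
        · exact ⟨i, j, by rw [h1, h2]⟩
        · exact ⟨i, j, by rw [h1, h2, Sym2.eq_swap]⟩
      refine ⟨i, j, ?_⟩
      have hd0 : d i j = 0 := by
        by_contra hne
        exact hnot (hij ▸ hd3 i j hne)
      simpa [hd0] using (he3 i j).2 hij

/-- Moving along a circulation that does not decrease a linear objective, one can cancel an entry
of the support. -/
theorem exists_smaller_support {A G : Type*} [Fintype A] [Fintype G] (c b d : A → G → ℝ)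
    (hb : ∀ i j, 0 ≤ b i j) (hrow : ∀ i, ∑ j, d i j = 0) (hcol : ∀ j, ∑ i, d i j = 0)
    (hsupp : ∀ i j, d i j ≠ 0 → 0 < b i j) (hd : ∃ i j, d i j ≠ 0)
    (hc : 0 ≤ ∑ i, ∑ j, c i j * d i j) :
    ∃ b' : A → G → ℝ, (∀ i j, 0 ≤ b' i j) ∧ (∀ i, ∑ j, b' i j = ∑ j, b i j) ∧
      (∀ j, ∑ i, b' i j = ∑ i, b i j) ∧ (∀ i j, b i j = 0 → b' i j = 0) ∧
      (∃ i j, b' i j = 0 ∧ b i j ≠ 0) ∧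
      ∑ i, ∑ j, c i j * b i j ≤ ∑ i, ∑ j, c i j * b' i j := by
  classical
  obtain ⟨i₀, j₀, h0⟩ := hd
  have hneg : ∃ j, d i₀ j < 0 := by
    by_contra! hall
    exact h0 ((sum_eq_zero_iff_of_nonneg fun j _ => hall j).1 (hrow i₀) j₀ (mem_univ _))
  obtain ⟨j₁, hj₁⟩ := hneg
  obtain ⟨⟨i, j⟩, hij, hmin⟩ := exists_min_image
    (univ.filter fun x : A × G => d x.1 x.2 < 0) (fun x => b x.1 x.2 / -d x.1 x.2)
    ⟨(i₀, j₁), by simpa using hj₁⟩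
  simp only [mem_filter, mem_univ, true_and, Prod.forall] at hij hmin
  set t := b i j / -d i j with ht
  have ht0 : 0 ≤ t := div_nonneg (hb i j) (by linarith)
  refine ⟨fun i j => b i j + t * d i j, fun k l => ?_, fun k => ?_, fun l => ?_,
    fun k l hkl => ?_, ⟨i, j, ?_, ?_⟩, ?_⟩
  · rcases lt_or_ge (d k l) 0 with hlt | hge
    · have := (le_div_iff₀ (neg_pos.2 hlt)).1 (hmin k l hlt)
      linarith
    · exact add_nonneg (hb k l) (mul_nonneg ht0 hge)
  · rw [sum_add_distrib, ← mul_sum, hrow]; ring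
  · rw [sum_add_distrib, ← mul_sum, hcol]; ring
  · have : d k l = 0 := by
      by_contra hne
      exact (hsupp k l hne).ne' hkl
    simp [hkl, this]
  · have := hij.ne
    simp only [ht]
    field_simp
    ring
  · exact (hsupp i j hij.ne).ne'
  · have : ∑ k, ∑ l, c k l * (b k l + t * d k l)
        = ∑ k, ∑ l, c k l * b k l + t * ∑ k, ∑ l, c k l * d k l := by
      simp only [mul_sum, ← sum_add_distrib]
      exact sum_congr rfl fun _ _ => sum_congr rfl fun _ _ => by ring
    rw [this]
    linarith [mul_nonneg ht0 hc]

/-- A linear objective on a transportation polytope can be improved to an acyclic point inside the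
support of a given point. -/
theorem exists_acyclic_linear_improvement {A G : Type*} [Fintype A] [Fintype G]
    (c b : A → G → ℝ) (hb : ∀ i j, 0 ≤ b i j) :
    ∃ b' : A → G → ℝ, (∀ i j, 0 ≤ b' i j) ∧ (∀ i, ∑ j, b' i j = ∑ j, b i j) ∧
      (∀ j, ∑ i, b' i j = ∑ i, b i j) ∧ (∀ i j, b i j = 0 → b' i j = 0) ∧
      (supportGraph b').IsAcyclic ∧
      ∑ i, ∑ j, c i j * b i j ≤ ∑ i, ∑ j, c i j * b' i j := by
  classical
  induction hN : (univ.filter fun x : A × G => b x.1 x.2 ≠ 0).card using Nat.strong_induction_on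
    generalizing b with
  | _ N ih =>
    by_cases hac : (supportGraph b).IsAcyclic
    · exact ⟨b, hb, fun _ => rfl, fun _ => rfl, fun _ _ h => h, hac, le_rfl⟩
    obtain ⟨d, hrow, hcol, hsupp, hd⟩ := exists_circulation_of_not_isAcyclic hac
    obtain ⟨b₁, h1, h2, h3, h4, ⟨i, j, hij, hij'⟩, h6⟩ : ∃ b' : A → G → ℝ, (∀ i j, 0 ≤ b' i j) ∧
        (∀ i, ∑ j, b' i j = ∑ j, b i j) ∧
        (∀ j, ∑ i, b' i j = ∑ i, b i j) ∧ (∀ i j, b i j = 0 → b' i j = 0) ∧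
        (∃ i j, b' i j = 0 ∧ b i j ≠ 0) ∧
        ∑ i, ∑ j, c i j * b i j ≤ ∑ i, ∑ j, c i j * b' i j := by
      rcases le_total 0 (∑ i, ∑ j, c i j * d i j) with hc | hc
      · exact exists_smaller_support c b d hb hrow hcol hsupp hd hc
      · exact exists_smaller_support c b (fun i j => -d i j) hb (by simp [hrow]) (by simp [hcol])
          (by simpa using hsupp) (by simpa using hd) (by simpa using hc)
    have hlt : (univ.filter fun x : A × G => b₁ x.1 x.2 ≠ 0).card < N := by
      rw [← hN]
      refine card_lt_card (ssubset_iff_of_subset ?_ |>.2 ⟨(i, j), by simpa using hij',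
        by simpa using hij⟩)
      intro x hx
      simp only [mem_filter, mem_univ, true_and] at hx ⊢
      exact fun h => hx (h4 _ _ h)
    obtain ⟨b₂, k1, k2, k3, k4, k5, k6⟩ := ih _ hlt b₁ h1 rfl
    exact ⟨b₂, k1, fun i => (k2 i).trans (h2 i), fun j => (k3 j).trans (h3 j),
      fun i j h => k4 i j (h4 i j h), k5, h6.trans k6⟩

theorem mul_log_div_le {s q n : ℝ} (hs : 0 ≤ s) (hq : 0 ≤ q) (hn : 0 < n)
    (hsq : q = 0 → s = 0) :
    s * Real.log q - s * Real.log s - s * Real.log n ≤ q / n - s := by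
  rcases hs.eq_or_lt with rfl | hs
  · simpa using div_nonneg hq hn.le
  have hq : 0 < q := hq.lt_of_ne fun h => hs.ne' (hsq h.symm)
  have h := Real.log_le_sub_one_of_pos (x := q / (s * n)) (by positivity)
  rw [Real.log_div hq.ne' (by positivity), Real.log_mul hs.ne' hn.ne'] at h
  have h := mul_le_mul_of_nonneg_left h hs.le
  have h2 : s * (q / (s * n) - 1) = q / n - s := by field_simp
  linarith

/-- The log-sum inequality. -/
theorem sum_mul_log_le {A : Type*} [Fintype A] (w b : A → ℝ) (hw : ∀ i, 0 < w i)
    (hb : ∀ i, 0 ≤ b i) :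
    (∑ i, w i * b i) * Real.log (∑ i, w i * b i) - (∑ i, w i * b i) * Real.log (∑ i, b i)
      ≤ ∑ i, w i * b i * Real.log (w i) := by
  rcases (sum_nonneg fun i (_ : i ∈ univ) => hb i).eq_or_lt with hq | hq
  · have h0 : ∀ i, b i = 0 := fun i =>
      (sum_eq_zero_iff_of_nonneg fun i _ => hb i).1 hq.symm i (mem_univ i)
    simp [h0]
  set q := ∑ i, b i
  have hs : 0 < ∑ i, w i * b i := by
    obtain ⟨i, -, hi⟩ := exists_lt_of_sum_lt (f := fun _ => (0 : ℝ)) (by simpa using hq)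
    exact sum_pos' (fun i _ => mul_nonneg (hw i).le (hb i)) ⟨i, mem_univ i, mul_pos (hw i) hi⟩
  set s := ∑ i, w i * b i with hsdef
  have hterm : ∀ i, w i * b i * Real.log s - w i * b i * Real.log q - w i * b i * Real.log (w i)
      ≤ b i * (s / q) - w i * b i := by
    intro i
    have hwi := hw i
    have h := Real.log_le_sub_one_of_pos (x := s / (q * w i)) (by positivity)
    rw [Real.log_div hs.ne' (by positivity), Real.log_mul hq.ne' hwi.ne'] at h
    have h := mul_le_mul_of_nonneg_left h (mul_nonneg hwi.le (hb i))
    have h2 : w i * b i * (s / (q * w i) - 1) = b i * (s / q) - w i * b i := by field_simp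
    linarith
  have h := sum_le_sum fun i (_ : i ∈ univ) => hterm i
  simp only [sum_sub_distrib, ← sum_mul] at h
  rw [← hsdef, mul_div_cancel₀ s hq.ne'] at h
  linarith

/-- The objective of the non-convex relaxation, which is linear once the column sums are fixed. -/
noncomputable def fncvx {A G : Type*} [Fintype A] [Fintype G]
    (v : A → G → ℝ) (w : A → ℝ) (b : A → G → ℝ) : ℝ :=
  (∑ i, ∑ j, w i * b i j * Real.log (v i j))
    - ∑ j, (∑ i, w i * b i j) * Real.log (∑ i, b i j)

theorem sum_sum_weight_mul {A G : Type*} [Fintype A] [Fintype G] (w : A → ℝ) {b : A → G → ℝ}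
    (hb : Feasible b) (u : A → ℝ) : ∑ j, ∑ i, w i * b i j * u i = ∑ i, w i * u i := by
  rw [sum_comm]
  refine sum_congr rfl fun i _ => ?_
  rw [← sum_mul, ← mul_sum, hb.2.1 i, mul_one]

theorem fncvx_le_fcvx {A G : Type*} [Fintype A] [Fintype G] (v : A → G → ℝ) {w : A → ℝ}
    (hw : ∀ i, 0 < w i) {b : A → G → ℝ} (hb : Feasible b) : fncvx v w b ≤ fcvx v w b := by
  have h := sum_le_sum fun j (_ : j ∈ univ) =>
    sum_mul_log_le w (fun i => b i j) hw (fun i => hb.1 i j)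
  rw [sum_sum_weight_mul w hb, sum_sub_distrib] at h
  unfold fncvx fcvx
  linarith

theorem fcvx_le_fncvx_add_DKL {A G : Type*} [Fintype A] [Fintype G] (v : A → G → ℝ) {w : A → ℝ}
    (hw : ∀ i, 0 < w i) (hws : ∑ i, w i = 1) {b : A → G → ℝ} (hb : Feasible b) :
    fcvx v w b ≤ fncvx v w b + DKL w := by
  have hn : (0 : ℝ) < Fintype.card A := by
    rcases isEmpty_or_nonempty A with hA | hA
    · simp at hws
    · exact_mod_cast Fintype.card_pos
  have h := sum_le_sum fun j (_ : j ∈ univ) =>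
    mul_log_div_le (s := ∑ i, w i * b i j) (q := ∑ i, b i j)
      (sum_nonneg fun i _ => mul_nonneg (hw i).le (hb.1 i j))
      (sum_nonneg fun i _ => hb.1 i j) hn (fun hq => sum_eq_zero fun i hi => by
        rw [(sum_eq_zero_iff_of_nonneg fun i _ => hb.1 i j).1 hq i hi, mul_zero])
  have hs : ∑ j, ∑ i, w i * b i j = 1 := by
    simpa [hws] using sum_sum_weight_mul w hb (fun _ => 1)
  have hq : ∑ j, ∑ i, b i j = Fintype.card A := by
    rw [sum_comm]
    simp [hb.2.1]
  simp only [sum_sub_distrib, ← sum_mul, ← sum_div] at h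
  rw [hs, hq, div_self hn.ne'] at h
  unfold fncvx fcvx DKL
  linarith

theorem fncvx_eq_linear {A G : Type*} [Fintype A] [Fintype G] (v : A → G → ℝ) (w : A → ℝ)
    (b : A → G → ℝ) :
    fncvx v w b
      = ∑ i, ∑ j, w i * (Real.log (v i j) - Real.log (∑ k, b k j)) * b i j := by
  unfold fncvx
  simp only [sum_mul]
  rw [sum_comm (s := (univ : Finset G)), ← sum_sub_distrib]
  refine sum_congr rfl fun i _ => ?_
  rw [← sum_sub_distrib]
  exact sum_congr rfl fun j _ => by ring

/-- Corollary `acyclic`: For any feasible point `b̄ ∈ P(𝒜,𝒢)` there exists an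
acyclic solution `b^forest ∈ P(𝒜,𝒢)` supported within the support of `b̄` with
`f_cvx(b^forest) ≥ f_cvx(b̄) − D_KL(w‖u)`. -/
theorem exists_acyclic_cvx_improvement
    (A G : Type*) [Fintype A] [Fintype G]
    (v : A → G → ℝ) (w : A → ℝ)
    (hv : ∀ i j, 0 ≤ v i j) (hw : ∀ i, 0 < w i) (hws : ∑ i, w i = 1)
    (bbar : A → G → ℝ) (hbbar : Feasible bbar) :
    ∃ bforest : A → G → ℝ, Feasible bforest ∧
      (supportGraph bforest).IsAcyclic ∧
      (∀ i j, bbar i j = 0 → bforest i j = 0) ∧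
      fcvx v w bforest ≥ fcvx v w bbar - DKL w := by
  obtain ⟨b, hnonneg, hrow, hcol, hsupp, hac, hle⟩ := exists_acyclic_linear_improvement
    (fun i j => w i * (Real.log (v i j) - Real.log (∑ k, bbar k j))) bbar hbbar.1
  have hb : Feasible b := ⟨hnonneg, fun i => (hrow i).trans (hbbar.2.1 i),
    fun j => (hcol j).trans_le (hbbar.2.2 j)⟩
  refine ⟨b, hb, hac, hsupp, ?_⟩
  have hmono : fncvx v w bbar ≤ fncvx v w b := by
    rw [fncvx_eq_linear, fncvx_eq_linear]
    simpa only [hcol] using hle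
  linarith [fncvx_le_fcvx v hw hb, fcvx_le_fncvx_add_DKL v hw hws hbbar]
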